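/- There is an absolute constant c (independent of T and s) such that for every tree T with n_T > 1 nodes and every parameter s with ⌈n_T/s⌉ ≥ 2, there exists a cluster partition CS of T such that |CS| ≤ c·s and |V(C)| ≤ ⌈n_T/s⌉ for every cluster C ∈ CS. -/

import Mathlib

namespace TreeIncl

/-- Rooted, ordered, labeled trees: a label and an ordered list of children. -/
inductive OTree (α : Type) : Type where
  | node : α → List (OTree α) → OTree α

namespace OTree

variable {α β : Type}

/-- The label of the root. -/
def label : OTree α → α
  | node a _ => a

/-- The (ordered) children subtrees of the root. -/
def children : OTree α → List (OTree α)
  | node _ cs => cs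

/-- Nodes are identified with positions: lists of child indices from the root. -/
abbrev Node : Type := List ℕ

/-- The subtree rooted at a given position, if the position is valid. -/
def sub : Node → OTree α → Option (OTree α)
  | [], t => some t
  | i :: p, t =>
    match t.children[i]? with
    | some c => sub p c
    | none => none

/-- The set `V(T)` of (positions of) nodes of a tree. -/
def Pos (t : OTree α) : Set Node := {p | sub p t ≠ none}

/-- The label of the node at position `p`. -/
def labelAt (t : OTree α) (p : Node) : Option α := (sub p t).map label

/-- `l_T`: the number of leaves of a tree. -/
def numLeaves : OTree α → ℕ
  | node _ [] => 1
  | node a (c :: cs) => numLeaves c + numLeaves (node a cs)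

/-- `n_T`: the number of nodes of a tree. -/
def numNodes : OTree α → ℕ
  | node _ [] => 1
  | node a (c :: cs) => numNodes c + numNodes (node a cs)

/-- The number of leaves of the subtree rooted at position `p` (0 if `p` is invalid). -/
def leavesAt (t : OTree α) (p : Node) : ℕ := ((sub p t).map numLeaves).getD 0

/-- `v ⪯ w` : `v` is an ancestor of `w` (positions: prefix). -/
def Anc (v w : Node) : Prop := v <+: w

/-- `v ≺ w` : `v` is a proper ancestor of `w` (positions: strict prefix). -/
def SAnc (v w : Node) : Prop := v <+: w ∧ v ≠ w

/-- `u ◁ w` : `u` is to the left of `w`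
    (equivalently: `pre(u) < pre(w)` and `post(u) < post(w)`). -/
def LeftOf (u w : Node) : Prop :=
  ∃ (q : Node) (i j : ℕ) (u' w' : Node), i < j ∧ u = q ++ i :: u' ∧ w = q ++ j :: w'

/-- `u ⊴ w` : `u ◁ w` or `u ⪯ w` or `w ≺ u`. -/
def LeftOrAbove (u w : Node) : Prop := LeftOf u w ∨ Anc u w ∨ SAnc w u

/-- The nearest common ancestor of two positions: longest common prefix. -/
def nca : Node → Node → Node
  | [], _ => []
  | _, [] => []
  | i :: u, j :: w => if i = j then i :: nca u w else []

/-- A set of nodes is deep: no node is a proper ancestor of another node in the set. -/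
def DeepSet (X : Set Node) : Prop := ∀ x ∈ X, ∀ y ∈ X, ¬ SAnc x y

/-- `Deep(X)`: the elements of `X` having no proper descendant in `X`. -/
def DeepOf (X : Set Node) : Set Node := {x | x ∈ X ∧ ¬ ∃ z ∈ X, SAnc x z}

/-- `Φ(X_1, …, X_k)`: xs is a tuple with `x_i ∈ X_i` and `x_1 ◁ x_2 ◁ ⋯ ◁ x_k`. -/
def Phi (Xs : List (Set Node)) (xs : List Node) : Prop :=
  List.Forall₂ (fun x X => x ∈ X) xs Xs ∧ xs.Chain' LeftOf

/-- `mop(X_1, …, X_k)`: the set of minimum ordered pairs. -/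
def Mop (Xs : List (Set Node)) : Set (Node × Node) :=
  {p | (∃ xs, Phi Xs xs ∧ xs.head? = some p.1 ∧ xs.getLast? = some p.2) ∧
    ¬ ∃ ys y1 yk, Phi Xs ys ∧ ys.head? = some y1 ∧ ys.getLast? = some yk ∧
      ((LeftOf p.1 y1 ∧ LeftOf y1 yk ∧ LeftOrAbove yk p.2) ∨
       (LeftOrAbove p.1 y1 ∧ LeftOf y1 yk ∧ LeftOf yk p.2))}

/-- `MopRight(Y, X)`: for `(y₁,y₂) ∈ Y`, `(y₁,x)` is in the result iff
    `(y₂,x) ∈ mop(Y|₂, X)`. -/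
def MopRight (Y : Set (Node × Node)) (X : Set Node) : Set (Node × Node) :=
  {r | ∃ y2, (r.1, y2) ∈ Y ∧ (y2, r.2) ∈ Mop [Prod.snd '' Y, X]}

/-- `MopLeft(X, Y)`: for `(y₁,y₂) ∈ Y`, `(x,y₂)` is in the result iff
    `(x,y₁) ∈ mop(X, Y|₁)`. -/
def MopLeft (X : Set Node) (Y : Set (Node × Node)) : Set (Node × Node) :=
  {r | ∃ y1, (y1, r.2) ∈ Y ∧ (r.1, y1) ∈ Mop [X, Prod.fst '' Y]}

/-- One deletion step: delete a node of the tree, making its children children of its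
parent (in its place, in order); the root may be deleted when it has exactly one
child. -/
inductive DelStep : OTree α → OTree α → Prop
  | root (a : α) (t : OTree α) : DelStep (node a [t]) t
  | splice (a b : α) (pre cs post : List (OTree α)) :
      DelStep (node a (pre ++ node b cs :: post)) (node a (pre ++ cs ++ post))
  | congr (a : α) (pre post : List (OTree α)) {t t' : OTree α} :
      DelStep t t' → DelStep (node a (pre ++ t :: post)) (node a (pre ++ t' :: post))

/-- `P ⊑ T` : `P` can be obtained from `T` by deleting nodes of `T`. -/
def Included (P T : OTree α) : Prop := Relation.ReflTransGen (fun x y => DelStep x y) T P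

/-- An embedding of `P` in `T`: an injective map of nodes preserving labels,
    proper ancestorship, and the left-of relation. -/
structure IsEmb (P T : OTree α) (f : Node → Node) : Prop where
  mem : ∀ p ∈ Pos P, f p ∈ Pos T
  inj : ∀ p ∈ Pos P, ∀ q ∈ Pos P, f p = f q → p = q
  lab : ∀ p ∈ Pos P, labelAt T (f p) = labelAt P p
  anc : ∀ p ∈ Pos P, ∀ q ∈ Pos P, (SAnc p q ↔ SAnc (f p) (f q))
  ord : ∀ p ∈ Pos P, ∀ q ∈ Pos P, (LeftOf p q ↔ LeftOf (f p) (f q))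

/-- A deep embedding: no other embedding maps the root of `P` strictly deeper. -/
def IsDeepEmb (P T : OTree α) (f : Node → Node) : Prop :=
  IsEmb P T f ∧ ¬ ∃ g, IsEmb P T g ∧ SAnc (f []) (g [])

/-- `emb(P,T)`: the set of deep occurrences of `P` in `T`. -/
def emb (P T : OTree α) : Set Node := {w | ∃ f, IsDeepEmb P T f ∧ f [] = w}

/-- `FlAt T x a q` : `q = fl(x, a)`, the first ancestor of `x` labeled `a` in `T`. -/
def FlAt (t : OTree α) (x : Node) (a : α) (q : Node) : Prop :=
  q <+: x ∧ labelAt t q = some a ∧ ∀ r, SAnc q r → r <+: x → labelAt t r ≠ some a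

/-! ### Heavy leaf path decompositions -/

/-- `hv` is a heavy leaf path decomposition of `P`: for each internal node (position)
`p`, `hv p` is the index of a child with the maximum number of descendant leaves. -/
def IsHeavyDecomp (P : OTree α) (hv : Node → ℕ) : Prop :=
  ∀ p s, sub p P = some s → s.children ≠ [] →
    ∃ c, s.children[hv p]? = some c ∧ ∀ c' ∈ s.children, numLeaves c' ≤ numLeaves c

/-- `ldepth(v)`: the number of light edges on the path from the root to `v`. -/
def ldepth (hv : Node → ℕ) (v : Node) : ℕ :=
  (List.range v.length).countP (fun n => v.getD n 0 != hv (v.take n))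

/-- The light nodes on the path from the root to `v`, ordered by increasing depth
    (the root is light; a nonroot node is light iff it is not the heavy child
    of its parent). -/
def lightPrefixes (hv : Node → ℕ) (v : Node) : List Node :=
  ((List.range (v.length + 1)).map (fun n => v.take n)).filter
    (fun q => q.getLast? != some (hv q.dropLast))

/-- The position of `heavy(parent(q))` for a nonroot position `q`. -/
def heavySibPos (hv : Node → ℕ) (q : Node) : Node :=
  q.dropLast ++ [hv q.dropLast]

/-! ### Clusters -/

/-- Two positions are adjacent in the tree (parent/child). -/
def Adj (u v : Node) : Prop := (∃ i, v = u ++ [i]) ∨ (∃ i, u = v ++ [i])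

/-- `S` is (the vertex set of) a nonempty connected subgraph of `T`. -/
def Conn (T : OTree α) (S : Set Node) : Prop :=
  S.Nonempty ∧ S ⊆ Pos T ∧
    ∀ u ∈ S, ∀ v ∈ S, ∀ w, nca u v <+: w → (w <+: u ∨ w <+: v) → w ∈ S

/-- The boundary nodes of a connected subgraph `S` of `T`: nodes of `S` adjacent to a
node of `T` outside `S`, together with the root of `T` if it lies in `S`. -/
def Boundary (T : OTree α) (S : Set Node) : Set Node :=
  {v ∈ S | (∃ u ∈ Pos T, u ∉ S ∧ Adj v u) ∨ v = []}

/-- The edges of `T` joining two nodes of `S`. -/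
def EdgesIn (T : OTree α) (S : Set Node) : Set (Node × Node) :=
  {e | e.1 ∈ S ∧ e.2 ∈ S ∧ e.2 ∈ Pos T ∧ ∃ i, e.2 = e.1 ++ [i]}

/-- A cluster of `T`: a connected subgraph with at most two boundary nodes. -/
def IsCluster (T : OTree α) (S : Set Node) : Prop :=
  Conn T S ∧ (Boundary T S).encard ≤ 2

/-- A cluster partition of `T`. -/
structure IsClusterPartition (T : OTree α) (CS : List (Set Node)) : Prop where
  cluster : ∀ S ∈ CS, IsCluster T S
  coverV : ∀ p ∈ Pos T, ∃ S ∈ CS, p ∈ S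
  coverE : ∀ e ∈ EdgesIn T (Pos T), ∃ S ∈ CS, e ∈ EdgesIn T S
  disjE : CS.Pairwise (fun S₁ S₂ => EdgesIn T S₁ ∩ EdgesIn T S₂ = ∅)
  edge : ∀ S ∈ CS, (EdgesIn T S).Nonempty

/-- Binary tree: every node has at most two children. -/
def IsBinary (t : OTree α) : Prop := ∀ p s, sub p t = some s → s.children.length ≤ 2

/-- Relabeling of a tree. -/
def omap (f : α → β) : OTree α → OTree β
  | node a cs => node (f a) (cs.attach.map (fun c => omap f c.1))
termination_by t => sizeOf t
decreasing_by
  have := List.sizeOf_lt_of_mem c.2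
  simp only [OTree.node.sizeOf_spec]
  omega


/-- The node set `{r} ∪ A` hangs below `r ∉ A`, is connected, and has no neighbour outside of
itself (within `V`) except at `r` and at `b`. -/
structure IsRootedCluster (V : Set Node) (r b : Node) (A : Finset Node) : Prop where
  root_mem : r ∈ V
  mem : ∀ u ∈ A, u ∈ V
  below : ∀ u ∈ A, r <+: u ∧ u ≠ r
  parent : ∀ u ∈ A, ∃ p i, u = p ++ [i] ∧ (p = r ∨ p ∈ A)
  bottom : ∀ u ∈ A, ∀ i, u ++ [i] ∈ V → u ++ [i] ∈ A ∨ u = b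

/-- The nodes of `P` (identified with their parent edges) are partitioned into at most `n`
rooted clusters of at most `k` edges each. -/
def Splits (V : Set Node) (k : ℕ) (P : Finset Node) (n : ℕ) : Prop :=
  ∃ L : List (Node × Finset Node), L.length ≤ n ∧
    (∀ x ∈ L, (∃ b, IsRootedCluster V x.1 b x.2) ∧ x.2.Nonempty ∧ x.2.card ≤ k) ∧
    L.Pairwise (fun x y => Disjoint x.2 y.2) ∧
    ∀ u, u ∈ P ↔ ∃ x ∈ L, u ∈ x.2

/-- Nodes strictly below `v`, closed under taking children in `V`. -/
structure IsPiece (V : Set Node) (v : Node) (X : Finset Node) : Prop where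
  root_mem : v ∈ V
  mem : ∀ u ∈ X, u ∈ V
  below : ∀ u ∈ X, v <+: u ∧ u ≠ v
  child : ∀ u ∈ X, ∀ i, u ++ [i] ∈ V → u ++ [i] ∈ X

/-- The piece `X` at `v` splits into an open cluster `A` containing the root `v`, and few
closed clusters. -/
def HasOpenSplit (V : Set Node) (k : ℕ) (v : Node) (X : Finset Node) : Prop :=
  ∃ (A : Finset Node) (b : Node) (n : ℕ), A ⊆ X ∧ IsRootedCluster V v b A ∧
    (∀ i, v ++ [i] ∈ X → v ++ [i] ∈ A ∨ v = b) ∧ A.card ≤ k ∧ Splits V k (X \ A) n ∧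
    (A = X ∨ k * n + 2 * k + 4 * A.card ≤ 4 * X.card)

section Splitting

variable {V : Set Node} {k : ℕ}

theorem Splits.empty : Splits V k ∅ 0 := ⟨[], by simp⟩

theorem IsRootedCluster.splits {r b : Node} {A : Finset Node} (h : IsRootedCluster V r b A)
    (hk : A.card ≤ k) : Splits V k A 1 := by
  rcases A.eq_empty_or_nonempty with rfl | hne
  · exact ⟨[], by simp⟩
  · exact ⟨[(r, A)], by simp, by simpa using ⟨⟨b, h⟩, hne, hk⟩, by simp, by simp⟩

theorem Splits.union {P Q : Finset Node} {m n : ℕ} (hP : Splits V k P m) (hQ : Splits V k Q n)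
    (hd : Disjoint P Q) : Splits V k (P ∪ Q) (m + n) := by
  obtain ⟨L, hl, hL, hLd, hLP⟩ := hP
  obtain ⟨M, ml, hM, hMd, hMQ⟩ := hQ
  refine ⟨L ++ M, by simp; omega, ?_, ?_, ?_⟩
  · intro x hx
    rcases List.mem_append.1 hx with h | h
    · exact hL x h
    · exact hM x h
  · refine List.pairwise_append.2 ⟨hLd, hMd, fun x hx y hy => ?_⟩
    refine hd.mono ?_ ?_
    · exact fun u hu => (hLP u).2 ⟨x, hx, hu⟩
    · exact fun u hu => (hMQ u).2 ⟨y, hy, hu⟩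
  · intro u
    simp only [Finset.mem_union, hLP, hMQ, List.mem_append, or_and_right, exists_or]

theorem Splits.absorb {r b : Node} {A X : Finset Node} {n : ℕ} (h : Splits V k (X \ A) n)
    (hA : IsRootedCluster V r b A) (hk : A.card ≤ k) (hAX : A ⊆ X) : Splits V k X (n + 1) := by
  have := h.union (hA.splits hk) Finset.sdiff_disjoint
  rwa [Finset.sdiff_union_of_subset hAX] at this

theorem IsPiece.rootedCluster_empty {v : Node} {X : Finset Node} (h : IsPiece V v X)
    (b : Node) : IsRootedCluster V v b ∅ :=
  ⟨h.root_mem, by simp, by simp, by simp, by simp⟩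

theorem IsPiece.hasOpenSplit_empty {v : Node} (h : IsPiece V v ∅) : HasOpenSplit V k v ∅ :=
  ⟨∅, v, 0, by simp, h.rootedCluster_empty v, by simp, by simp, by simpa using Splits.empty,
    Or.inl rfl⟩

/-- Add the edge from `v` to its child, the root of the piece `Y`. -/
theorem HasOpenSplit.lift {v : Node} {j : ℕ} {Y : Finset Node} (hk : 1 ≤ k) (hv : v ∈ V)
    (hY : IsPiece V (v ++ [j]) Y) (hch : ∀ i, v ++ [j] ++ [i] ∈ V → v ++ [j] ++ [i] ∈ Y)
    (h : HasOpenSplit V k (v ++ [j]) Y) : HasOpenSplit V k v (insert (v ++ [j]) Y) := by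
  obtain ⟨A, b, n, hAY, hA, hAb, hAk, hs, hn⟩ := h
  have hcY : v ++ [j] ∉ Y := fun hc => (hY.below _ hc).2 rfl
  have hcA : v ++ [j] ∉ A := fun hc => hcY (hAY hc)
  have hroot : ∀ i, v ++ [i] ∈ insert (v ++ [j]) Y → v ++ [i] = v ++ [j] := by
    intro i hi
    rcases Finset.mem_insert.1 hi with hi | hi
    · exact hi
    · exact ((hY.below _ hi).1.eq_of_length (by simp)).symm
  by_cases hlt : A.card < k
  · refine ⟨insert (v ++ [j]) A, b, n, Finset.insert_subset_insert _ hAY,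
      ⟨hv, ?_, ?_, ?_, ?_⟩, ?_, ?_, ?_, ?_⟩
    · intro u hu
      rcases Finset.mem_insert.1 hu with rfl | hu
      · exact hA.root_mem
      · exact hA.mem u hu
    · intro u hu
      rcases Finset.mem_insert.1 hu with rfl | hu
      · simp
      · have h1 := (hA.below u hu).1
        refine ⟨(List.prefix_append v [j]).trans h1, ?_⟩
        rintro rfl
        simpa using h1.length_le
    · intro u hu
      rcases Finset.mem_insert.1 hu with rfl | hu
      · exact ⟨v, j, rfl, Or.inl rfl⟩
      · obtain ⟨p, i, rfl, hp⟩ := hA.parent u hu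
        exact ⟨p, i, rfl, Or.inr (Finset.mem_insert.2 hp)⟩
    · intro u hu i hi
      rcases Finset.mem_insert.1 hu with rfl | hu
      · exact (hAb i (hch i hi)).imp_left Finset.mem_insert_of_mem
      · exact (hA.bottom u hu i hi).imp_left Finset.mem_insert_of_mem
    · intro i hi
      left
      rw [hroot i hi]
      exact Finset.mem_insert_self _ _
    · rw [Finset.card_insert_of_notMem hcA]; omega
    · have : insert (v ++ [j]) Y \ insert (v ++ [j]) A = Y \ A := by
        ext u
        simp only [Finset.mem_sdiff, Finset.mem_insert]
        constructor
        · tauto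
        · rintro ⟨h1, h2⟩
          exact ⟨Or.inr h1, fun h => h.elim (fun h => hcY (h ▸ h1)) h2⟩
      rwa [this]
    · rw [Finset.card_insert_of_notMem hcA, Finset.card_insert_of_notMem hcY]
      rcases hn with rfl | hn
      · exact Or.inl rfl
      · right; omega
  · have hkA : A.card = k := by omega
    have hcl : IsRootedCluster V v (v ++ [j]) {v ++ [j]} :=
      ⟨hv, by simpa using hY.root_mem, by simp, by simp, by simp⟩
    have hdiff : insert (v ++ [j]) Y \ {v ++ [j]} = Y := by
      rw [Finset.insert_sdiff_of_mem _ (by simp), Finset.sdiff_singleton_eq_erase, Finset.erase_eq_of_notMem hcY]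
    have hbot : ∀ i, v ++ [i] ∈ insert (v ++ [j]) Y →
        v ++ [i] ∈ ({v ++ [j]} : Finset Node) ∨ v = v ++ [j] :=
      fun i hi => Or.inl (by simpa using hroot i hi)
    rcases hn with rfl | hn
    · refine ⟨{v ++ [j]}, v ++ [j], 1, by simp, hcl, hbot, by simpa using hk, ?_, Or.inr ?_⟩
      · rw [hdiff]
        exact hA.splits hAk
      · rw [Finset.card_insert_of_notMem hcY, Finset.card_singleton]
        omega
    · refine ⟨{v ++ [j]}, v ++ [j], n + 1, by simp, hcl, hbot, by simpa using hk, ?_, Or.inr ?_⟩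
      · rw [hdiff]
        exact hs.absorb hA hAk hAY
      · rw [Finset.card_insert_of_notMem hcY, Finset.card_singleton, Nat.mul_succ]
        omega

/-- Merge an open cluster that fills its piece with another open cluster at the same root. -/
theorem HasOpenSplit.union_of_full {v b : Node} {n : ℕ} {X Y A : Finset Node}
    (hX : IsPiece V v X) (hd : Disjoint X Y) (hXc : IsRootedCluster V v v X)
    (hAY : A ⊆ Y) (hA : IsRootedCluster V v b A)
    (hAb : ∀ i, v ++ [i] ∈ Y → v ++ [i] ∈ A ∨ v = b) (hs : Splits V k (Y \ A) n)
    (hn : A = Y ∨ k * n + 2 * k + 4 * A.card ≤ 4 * Y.card) (hk : X.card + A.card ≤ k) :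
    HasOpenSplit V k v (X ∪ Y) := by
  have hXA : Disjoint X A := hd.mono_right hAY
  refine ⟨X ∪ A, b, n, Finset.union_subset_union_right hAY, ⟨hX.root_mem, ?_, ?_, ?_, ?_⟩,
    ?_, ?_, ?_, ?_⟩
  · intro u hu
    exact (Finset.mem_union.1 hu).elim (hX.mem u) (hA.mem u)
  · intro u hu
    exact (Finset.mem_union.1 hu).elim (hX.below u) (hA.below u)
  · intro u hu
    rcases Finset.mem_union.1 hu with hu | hu
    · obtain ⟨p, i, h, hp⟩ := hXc.parent u hu
      exact ⟨p, i, h, hp.imp_right (Finset.mem_union_left _)⟩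
    · obtain ⟨p, i, h, hp⟩ := hA.parent u hu
      exact ⟨p, i, h, hp.imp_right (Finset.mem_union_right _)⟩
  · intro u hu i hi
    rcases Finset.mem_union.1 hu with hu | hu
    · exact Or.inl (Finset.mem_union_left _ (hX.child u hu i hi))
    · exact (hA.bottom u hu i hi).imp_left (Finset.mem_union_right _)
  · intro i hi
    rcases Finset.mem_union.1 hi with hi | hi
    · exact Or.inl (Finset.mem_union_left _ hi)
    · exact (hAb i hi).imp_left (Finset.mem_union_right _)
  · rwa [Finset.card_union_of_disjoint hXA]
  · have : (X ∪ Y) \ (X ∪ A) = Y \ A := by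
      ext u
      have : u ∈ X → u ∉ Y := fun h => Finset.disjoint_left.1 hd h
      simp only [Finset.mem_sdiff, Finset.mem_union]
      tauto
    rwa [this]
  · rw [Finset.card_union_of_disjoint hXA, Finset.card_union_of_disjoint hd]
    rcases hn with rfl | hn
    · exact Or.inl rfl
    · right; omega

theorem IsPiece.full {v b : Node} {X : Finset Node} (hX : IsPiece V v X)
    (h : IsRootedCluster V v b X) : IsRootedCluster V v v X :=
  ⟨h.root_mem, h.mem, h.below, h.parent, fun u hu i hi => Or.inl (hX.child u hu i hi)⟩

theorem HasOpenSplit.union {v : Node} {X Y : Finset Node} (hX : IsPiece V v X)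
    (hY : IsPiece V v Y) (hd : Disjoint X Y) (h : HasOpenSplit V k v X)
    (h' : HasOpenSplit V k v Y) : HasOpenSplit V k v (X ∪ Y) := by
  obtain ⟨A, b, n, hAX, hA, hAb, hAk, hs, hn⟩ := h
  obtain ⟨B, b', n', hBY, hB, hBb, hBk, hs', hn'⟩ := h'
  have close : ∀ m m', Splits V k X m → Splits V k Y m' →
      k * (m + m') + 2 * k ≤ 4 * (X.card + Y.card) → HasOpenSplit V k v (X ∪ Y) := by
    intro m m' hm hm' hle
    refine ⟨∅, v, m + m', by simp, hX.rootedCluster_empty v, fun i _ => Or.inr rfl, by simp, ?_,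
      Or.inr ?_⟩
    · simpa using hm.union hm' hd
    · simpa [Finset.card_union_of_disjoint hd] using hle
  rcases hn with rfl | hn
  · by_cases hle : A.card + B.card ≤ k
    · exact .union_of_full hX hd (hX.full hA) hBY hB hBb hs' hn' hle
    · rcases hn' with rfl | hn'
      · exact close 1 1 (hA.splits hAk) (hB.splits hBk) (by omega)
      · refine close 1 (n' + 1) (hA.splits hAk) (hs'.absorb hB hBk hBY) ?_
        simp only [Nat.mul_add, Nat.mul_one]
        omega
  · rcases hn' with rfl | hn'
    · by_cases hle : B.card + A.card ≤ k
      · rw [Finset.union_comm]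
        exact .union_of_full hY hd.symm (hY.full hB) hAX hA hAb hs (Or.inr hn) hle
      · refine close (n + 1) 1 (hs.absorb hA hAk hAX) (hB.splits hBk) ?_
        simp only [Nat.mul_add, Nat.mul_one]
        omega
    · refine close (n + 1) (n' + 1) (hs.absorb hA hAk hAX) (hs'.absorb hB hBk hBY) ?_
      simp only [Nat.mul_add, Nat.mul_one]
      omega

theorem HasOpenSplit.splits {v : Node} {X : Finset Node} (h : HasOpenSplit V k v X) :
    ∃ n, Splits V k X n ∧ k * n ≤ 4 * X.card + k := by
  obtain ⟨A, b, n, hAX, hA, hAb, hAk, hs, hn⟩ := h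
  rcases hn with rfl | hn
  · exact ⟨1, hA.splits hAk, by omega⟩
  · exact ⟨n + 1, hs.absorb hA hAk hAX, by rw [Nat.mul_succ]; omega⟩

end Splitting

theorem nil_mem_Pos (t : OTree α) : [] ∈ Pos t := by simp [Pos, sub]

theorem cons_zero_mem_Pos {a : α} {c : OTree α} {cs : List (OTree α)} {p : Node} :
    0 :: p ∈ Pos (node a (c :: cs)) ↔ p ∈ Pos c := by
  simp [Pos, sub, children]

theorem cons_succ_mem_Pos {a : α} {c : OTree α} {cs : List (OTree α)} {i : ℕ} {p : Node} :
    (i + 1) :: p ∈ Pos (node a (c :: cs)) ↔ i :: p ∈ Pos (node a cs) := by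
  simp [Pos, sub, children]

theorem cons_notMem_Pos_leaf {a : α} {i : ℕ} {p : Node} : i :: p ∉ Pos (node a []) := by
  simp [Pos, sub, children]

theorem isPiece_of_mem_iff {V : Set Node} {v : Node} {j : ℕ} {X : Finset Node} (hv : v ∈ V)
    (hX : ∀ u, u ∈ X ↔ u ∈ V ∧ ∃ i p, u = v ++ (j + i) :: p) : IsPiece V v X := by
  refine ⟨hv, fun u hu => ((hX u).1 hu).1, ?_, ?_⟩
  · intro u hu
    obtain ⟨-, i, p, rfl⟩ := (hX u).1 hu
    simp
  · intro u hu l hl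
    obtain ⟨-, i, p, rfl⟩ := (hX u).1 hu
    exact (hX _).2 ⟨hl, i, p ++ [l], by simp⟩

/-- If `V` looks like `t` below `v`, starting from the child of index `j`, then that part of `V`
has an open split. -/
theorem exists_hasOpenSplit {V : Set Node} {k : ℕ} (hk : 1 ≤ k) (t : OTree α) :
    ∀ v j, v ∈ V → (∀ i p, v ++ (j + i) :: p ∈ V ↔ i :: p ∈ Pos t) →
    ∃ X : Finset Node, X.card + 1 = numNodes t ∧
      (∀ u, u ∈ X ↔ u ∈ V ∧ ∃ i p, u = v ++ (j + i) :: p) ∧ HasOpenSplit V k v X := by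
  induction t using numNodes.induct with
  | case1 a =>
    intro v j hv h
    have hX : ∀ u, u ∈ (∅ : Finset Node) ↔ u ∈ V ∧ ∃ i p, u = v ++ (j + i) :: p := by
      intro u
      simp only [Finset.notMem_empty, false_iff]
      rintro ⟨hu, i, p, rfl⟩
      exact cons_notMem_Pos_leaf ((h i p).1 hu)
    exact ⟨∅, by simp [numNodes], hX, (isPiece_of_mem_iff hv hX).hasOpenSplit_empty⟩
  | case2 a c cs ihc ihcs =>
    intro v j hv h
    have hzero : ∀ p, v ++ j :: p ∈ V ↔ p ∈ Pos c := fun p => by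
      simpa [cons_zero_mem_Pos] using h 0 p
    have hc : v ++ [j] ∈ V := (hzero []).2 (nil_mem_Pos c)
    obtain ⟨Y, hYcard, hY, hYs⟩ := ihc (v ++ [j]) 0 hc (fun i p => by
      simpa using hzero (i :: p))
    obtain ⟨X, hXcard, hX, hXs⟩ := ihcs v (j + 1) hv (fun i p => by
      rw [← cons_succ_mem_Pos (c := c), ← h, Nat.add_right_comm, Nat.add_assoc])
    have hYp := isPiece_of_mem_iff hc hY
    have hcY : v ++ [j] ∉ Y := fun hm => (hYp.below _ hm).2 rfl
    have hZ : ∀ u, u ∈ insert (v ++ [j]) Y ↔ u ∈ V ∧ ∃ p, u = v ++ j :: p := by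
      intro u
      rw [Finset.mem_insert, hY]
      constructor
      · rintro (rfl | ⟨hu, i, p, rfl⟩)
        · exact ⟨hc, [], rfl⟩
        · exact ⟨hu, (0 + i) :: p, by simp⟩
      · rintro ⟨hu, p, rfl⟩
        cases p with
        | nil => exact Or.inl rfl
        | cons i p => exact Or.inr ⟨hu, i, p, by simp⟩
    have hZp : IsPiece V v (insert (v ++ [j]) Y) := by
      refine ⟨hv, fun u hu => ((hZ u).1 hu).1, ?_, ?_⟩
      · intro u hu
        obtain ⟨-, p, rfl⟩ := (hZ u).1 hu
        simp
      · intro u hu l hl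
        obtain ⟨-, p, rfl⟩ := (hZ u).1 hu
        exact (hZ _).2 ⟨hl, p ++ [l], by simp⟩
    have hd : Disjoint (insert (v ++ [j]) Y) X := by
      refine Finset.disjoint_left.2 fun u hu hu' => ?_
      obtain ⟨-, p, rfl⟩ := (hZ u).1 hu
      obtain ⟨-, i, q, hq⟩ := (hX _).1 hu'
      simp only [List.append_cancel_left_eq, List.cons.injEq] at hq
      omega
    refine ⟨insert (v ++ [j]) Y ∪ X, ?_, ?_, ?_⟩
    · rw [Finset.card_union_of_disjoint hd, Finset.card_insert_of_notMem hcY, numNodes]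
      omega
    · intro u
      rw [Finset.mem_union, hZ, hX, ← and_or_left]
      refine and_congr_right fun _ => ⟨?_, ?_⟩
      · rintro (⟨p, rfl⟩ | ⟨i, p, rfl⟩)
        · exact ⟨0, p, rfl⟩
        · exact ⟨i + 1, p, by rw [Nat.add_right_comm, Nat.add_assoc]⟩
      · rintro ⟨i, p, rfl⟩
        cases i with
        | zero => exact Or.inl ⟨p, rfl⟩
        | succ i => exact Or.inr ⟨i, p, by rw [Nat.add_right_comm, Nat.add_assoc]⟩
    · refine .union hZp (isPiece_of_mem_iff hv hX) hd (.lift hk hv hYp ?_ hYs) hXs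
      exact fun i hi => (hY _).2 ⟨hi, i, [], by simp⟩

theorem prefix_nca : ∀ {r u v : Node}, r <+: u → r <+: v → r <+: nca u v
  | [], _, _, _, _ => List.nil_prefix
  | i :: r, u, v, hu, hv => by
    obtain ⟨u, rfl⟩ := hu
    obtain ⟨v, rfl⟩ := hv
    simpa [nca] using prefix_nca (List.prefix_append r u) (List.prefix_append r v)

section Cluster

variable {T : OTree α} {r b : Node} {A : Finset Node}

theorem IsRootedCluster.root_prefix {V : Set Node} (h : IsRootedCluster V r b A) {u : Node}
    (hu : u ∈ insert r (A : Set Node)) : r <+: u := by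
  rcases hu with rfl | hu
  · exact List.prefix_rfl
  · exact (h.below u hu).1

theorem IsRootedCluster.mem_of_prefix {V : Set Node} (h : IsRootedCluster V r b A) {u w : Node}
    (hu : u ∈ insert r (A : Set Node)) (hr : r <+: w) (hw : w <+: u) :
    w ∈ insert r (A : Set Node) := by
  induction u using List.reverseRecOn with
  | nil => rwa [List.prefix_nil.1 hw]
  | append_singleton p i ih =>
    rcases List.prefix_concat_iff.1 hw with rfl | hw'
    · exact hu
    · rcases hu with rfl | hu
      · left
        exact hw.eq_of_length (le_antisymm hw.length_le hr.length_le)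
      · obtain ⟨q, l, hq, hm⟩ := h.parent _ hu
        obtain ⟨rfl, -⟩ := List.append_singleton_inj.1 hq
        exact ih hm hw'

theorem IsRootedCluster.isCluster (h : IsRootedCluster (Pos T) r b A) :
    IsCluster T (insert r (A : Set Node)) := by
  refine ⟨⟨⟨r, Set.mem_insert _ _⟩, ?_, ?_⟩, ?_⟩
  · rintro u (rfl | hu)
    · exact h.root_mem
    · exact h.mem u hu
  · intro u hu v hv w hw hor
    have hr : r <+: w := (prefix_nca (h.root_prefix hu) (h.root_prefix hv)).trans hw
    rcases hor with hw | hw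
    · exact h.mem_of_prefix hu hr hw
    · exact h.mem_of_prefix hv hr hw
  · have hpair : ({r, b} : Set Node).encard ≤ 2 := by
      simpa [one_add_one_eq_two] using Set.encard_insert_le {b} r
    refine (Set.encard_le_encard ?_).trans hpair
    rintro u ⟨rfl | hu, hb⟩
    · exact Or.inl rfl
    · rcases hb with ⟨w, hw, hwS, ⟨i, rfl⟩ | ⟨i, rfl⟩⟩ | rfl
      · exact Or.inr ((h.bottom u hu i hw).resolve_left fun hA => hwS (Or.inr hA))
      · obtain ⟨q, l, hq, hm⟩ := h.parent _ hu
        obtain ⟨rfl, -⟩ := List.append_singleton_inj.1 hq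
        exact absurd hm hwS
      · have := h.below [] hu
        exact absurd (List.prefix_nil.1 this.1).symm this.2

theorem IsRootedCluster.mem_edgesIn (h : IsRootedCluster (Pos T) r b A) {p : Node} {i : ℕ}
    (hp : p ++ [i] ∈ A) : (p, p ++ [i]) ∈ EdgesIn T (insert r (A : Set Node)) := by
  obtain ⟨q, l, hq, hm⟩ := h.parent _ hp
  obtain ⟨rfl, -⟩ := List.append_singleton_inj.1 hq
  exact ⟨hm, Or.inr hp, h.mem _ hp, i, rfl⟩

theorem IsRootedCluster.snd_mem (h : IsRootedCluster (Pos T) r b A) {e : Node × Node}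
    (he : e ∈ EdgesIn T (insert r (A : Set Node))) : e.2 ∈ A := by
  obtain ⟨h1, h2, -, i, hi⟩ := he
  refine h2.resolve_left fun hr => ?_
  have := (h.root_prefix h1).length_le
  rw [← hr, hi] at this
  simp at this

theorem exists_edge_nil (h : 1 < numNodes T) : ([], [0]) ∈ EdgesIn T (Pos T) := by
  rcases T with ⟨a, _ | ⟨c, cs⟩⟩
  · simp [numNodes] at h
  · have := (cons_zero_mem_Pos (a := a) (cs := cs)).2 (nil_mem_Pos c)
    exact ⟨nil_mem_Pos _, this, this, 0, rfl⟩

theorem Splits.exists_isClusterPartition {k n : ℕ} {X : Finset Node}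
    (hT : 1 < numNodes T) (hX : ∀ u, u ∈ X ↔ u ∈ Pos T ∧ u ≠ [])
    (h : Splits (Pos T) k X n) :
    ∃ CS : List (Set Node), IsClusterPartition T CS ∧ CS.length ≤ n ∧
      ∀ S ∈ CS, S.ncard ≤ k + 1 := by
  obtain ⟨L, hl, hL, hLd, hLX⟩ := h
  have hE : ∀ e ∈ EdgesIn T (Pos T),
      ∃ S ∈ L.map (fun x => insert x.1 (x.2 : Set Node)), e ∈ EdgesIn T S := by
    rintro ⟨p, q⟩ ⟨-, hq, -, i, rfl : q = p ++ [i]⟩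
    obtain ⟨x, hx, hm⟩ := (hLX _).1 ((hX (p ++ [i])).2 ⟨hq, by simp⟩)
    obtain ⟨⟨b, hb⟩, -⟩ := hL x hx
    exact ⟨_, List.mem_map_of_mem hx, hb.mem_edgesIn hm⟩
  refine ⟨L.map (fun x => insert x.1 (x.2 : Set Node)), ⟨?_, ?_, hE, ?_, ?_⟩, by simpa, ?_⟩
  · simp only [List.mem_map]
    rintro _ ⟨x, hx, rfl⟩
    obtain ⟨⟨b, hb⟩, -⟩ := hL x hx
    exact hb.isCluster
  · intro p hp
    by_cases h0 : p = []
    · subst h0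
      obtain ⟨S, hS, he⟩ := hE _ (exists_edge_nil hT)
      exact ⟨S, hS, he.1⟩
    · obtain ⟨x, hx, hm⟩ := (hLX _).1 ((hX p).2 ⟨hp, h0⟩)
      exact ⟨_, List.mem_map_of_mem hx, Or.inr hm⟩
  · refine List.pairwise_map.2 (hLd.imp_of_mem fun {x y} hx hy hd => ?_)
    obtain ⟨⟨b, hb⟩, -⟩ := hL x hx
    obtain ⟨⟨b', hb'⟩, -⟩ := hL y hy
    refine Set.eq_empty_of_forall_notMem fun e he => ?_
    exact Finset.disjoint_left.1 hd (hb.snd_mem he.1) (hb'.snd_mem he.2)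
  · simp only [List.mem_map]
    rintro _ ⟨x, hx, rfl⟩
    obtain ⟨⟨b, hb⟩, ⟨u, hu⟩, -⟩ := hL x hx
    obtain ⟨p, i, rfl, -⟩ := hb.parent u hu
    exact ⟨_, hb.mem_edgesIn hu⟩
  · simp only [List.mem_map]
    rintro _ ⟨x, hx, rfl⟩
    obtain ⟨-, -, hc⟩ := hL x hx
    refine (Set.ncard_insert_le _ _).trans ?_
    rw [Set.ncard_coe_finset]
    omega

end Cluster

/-- (Lemma 9) There is an absolute constant `c` such that every
tree `T` with `n_T > 1` and every parameter `s` with `⌈n_T/s⌉ ≥ 2` admits a cluster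
partition `CS` with `|CS| ≤ c·s` and `|V(C)| ≤ ⌈n_T/s⌉` for every `C ∈ CS`. -/
theorem cluster_partition_exists :
    ∃ c : ℕ, ∀ (α : Type) (T : OTree α) (s : ℕ),
      1 < numNodes T → 2 ≤ (numNodes T + s - 1) / s →
      ∃ CS : List (Set Node), IsClusterPartition T CS ∧
        CS.length ≤ c * s ∧
        ∀ S ∈ CS, S.ncard ≤ (numNodes T + s - 1) / s := by
  refine ⟨9, fun α T s hT hm => ?_⟩
  have hs : 0 < s := by
    rcases Nat.eq_zero_or_pos s with rfl | hs
    · simp at hm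
    · exact hs
  obtain ⟨k, hk⟩ : ∃ k, (numNodes T + s - 1) / s = k + 1 :=
    ⟨_, (Nat.succ_pred_eq_of_pos (by omega)).symm⟩
  have hk1 : 1 ≤ k := by omega
  rw [hk]
  obtain ⟨X, hcard, hX, hsplit⟩ := exists_hasOpenSplit (V := Pos T) hk1 T [] 0 (nil_mem_Pos T)
    (fun i p => by simp)
  obtain ⟨n, hn, hle⟩ := hsplit.splits
  have hX' : ∀ u, u ∈ X ↔ u ∈ Pos T ∧ u ≠ [] := by
    intro u
    rw [hX]
    refine and_congr_right fun _ => ?_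
    cases u <;> simp
  obtain ⟨CS, hCS, hlen, hsize⟩ := hn.exists_isClusterPartition hT hX'
  refine ⟨CS, hCS, hlen.trans ?_, hsize⟩
  have hlt : numNodes T + s - 1 < s * (k + 2) := by
    rw [Nat.mul_comm, ← Nat.div_lt_iff_lt_mul hs]
    omega
  have hXs : X.card ≤ 2 * (k * s) := by
    have : s ≤ k * s := Nat.le_mul_of_pos_left s hk1
    have : s * (k + 2) = k * s + 2 * s := by ring
    omega
  have hks : k ≤ k * s := Nat.le_mul_of_pos_right k hs
  refine Nat.le_of_mul_le_mul_left (c := k) ?_ hk1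
  calc k * n ≤ 9 * (k * s) := by omega
    _ = k * (9 * s) := by ring

end OTree

end TreeIncl
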